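/- arXiv:1510.02875 — 3 statements merged into one kernel-verified Lean document; each statement's English description precedes it below -/
import Mathlib

section
/- For every odd positive integer n, there is a complete legal game sequence on the n×n chessboard, i.e., a legal game sequence of length n² that enumerates all n² squares of the board. -/
/-- Two distinct squares `(a,b)` and `(c,d)` attack each other if `a = c`, `b = d`,
`a + b = c + d`, or `a - b = c - d` (the last encoded as `a + d = c + b`). -/
def attacks (p q : ℕ × ℕ) : Prop :=
  p ≠ q ∧ (p.1 = q.1 ∨ p.2 = q.2 ∨ p.1 + p.2 = q.1 + q.2 ∨ p.1 + q.2 = q.1 + p.2)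

instance : ∀ p q : ℕ × ℕ, Decidable (attacks p q) := fun p q => by
  unfold attacks; infer_instance

/-- The squares of the `n × n` chessboard: pairs `(i,j)` with `1 ≤ i, j ≤ n`. -/
def board (n : ℕ) : Finset (ℕ × ℕ) := Finset.Icc 1 n ×ˢ Finset.Icc 1 n

/-- A legal game sequence: pairwise distinct squares of the board such that each newly
placed queen lands on a square attacked by an even number of previously placed queens. -/
def IsLegalSeq (n : ℕ) {k : ℕ} (q : Fin k → ℕ × ℕ) : Prop :=
  Function.Injective q ∧ (∀ i, q i ∈ board n) ∧
    ∀ i : Fin k, Even ((Finset.univ.filter fun j : Fin k => j < i ∧ attacks (q j) (q i)).card)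

/-- A set `S` of squares is locked if every square of the board not in `S` is attacked by
an odd number of squares of `S`. -/
def Locked (n : ℕ) (S : Finset (ℕ × ℕ)) : Prop :=
  ∀ p ∈ board n, p ∉ S → Odd ((S.filter fun s => attacks s p).card)


namespace QueenParity

/-- The parity of the number of lines (rows, columns, diagonals) shared by `s` and `p`. -/
def lineParity (s p : ℤ × ℤ) : ZMod 2 :=
  (if s.1 = p.1 then 1 else 0) + (if s.2 = p.2 then 1 else 0) +
    (if s.1 + s.2 = p.1 + p.2 then 1 else 0) + (if s.1 - s.2 = p.1 - p.2 then 1 else 0)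

/-- The parity of the number of squares of `L` attacking `p`. -/
def parity (L : List (ℤ × ℤ)) (p : ℤ × ℤ) : ZMod 2 := (L.map (lineParity · p)).sum

/-- Each square of the list is attacked by an even number of the squares after it,
so that the list read backwards is a game. -/
def Legal : List (ℤ × ℤ) → Prop
  | [] => True
  | p :: L => parity L p = 0 ∧ Legal L

@[simp] lemma parity_nil (p : ℤ × ℤ) : parity [] p = 0 := rfl

@[simp] lemma parity_cons (s : ℤ × ℤ) (L : List (ℤ × ℤ)) (p : ℤ × ℤ) :
    parity (s :: L) p = lineParity s p + parity L p := by simp [parity]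

@[simp] lemma parity_append (L M : List (ℤ × ℤ)) (p : ℤ × ℤ) :
    parity (L ++ M) p = parity L p + parity M p := by simp [parity]

@[simp] lemma lineParity_self (p : ℤ × ℤ) : lineParity p p = 0 := by
  simp only [lineParity, if_true]; decide

lemma Legal.append {L M : List (ℤ × ℤ)} (hL : Legal L) (hM : Legal M)
    (h : ∀ p, parity M p = 0) : Legal (L ++ M) := by
  induction L with
  | nil => exact hM
  | cons p L ih => exact ⟨by simp [hL.1, h], ih hL.2⟩

/-- A legal list can be played backwards after `L` if all its squares see an even number of
squares in total. -/
lemma Legal.reverse_append {M L : List (ℤ × ℤ)} (hM : Legal M) (hL : Legal L)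
    (h : ∀ p ∈ M, parity M p + parity L p = 0) : Legal (M.reverse ++ L) := by
  induction M generalizing L with
  | nil => exact hL
  | cons p M ih =>
    rw [List.reverse_cons, List.append_assoc]
    refine ih hM.2 ⟨?_, hL⟩ fun r hr => ?_
    · simpa [hM.1] using h p (by simp)
    · have := h r (by simp [hr])
      simp only [parity_cons, List.singleton_append] at this ⊢
      rw [← this]; ring

/-- Rotation of the board by a quarter turn. -/
def rot (p : ℤ × ℤ) : ℤ × ℤ := (-p.2, p.1)

lemma lineParity_rot (s p : ℤ × ℤ) : lineParity (rot s) (rot p) = lineParity s p := by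
  obtain ⟨a, b⟩ := s
  obtain ⟨c, d⟩ := p
  have h₁ : -b + a = -d + c ↔ a - b = c - d := by omega
  have h₂ : -b - a = -d - c ↔ a + b = c + d := by omega
  simp only [rot]
  simp only [lineParity, neg_inj, h₁, h₂]
  ring

lemma parity_map_rot (L : List (ℤ × ℤ)) (p : ℤ × ℤ) :
    parity (L.map rot) (rot p) = parity L p := by
  induction L with
  | nil => rfl
  | cons s L ih => simp [ih, lineParity_rot]

lemma Legal.map_rot {L : List (ℤ × ℤ)} (hL : Legal L) : Legal (L.map rot) := by
  induction L with
  | nil => trivial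
  | cons p L ih => exact ⟨by rw [parity_map_rot]; exact hL.1, ih hL.2⟩

lemma legal_flatMap {α : Type*} (f : α → List (ℤ × ℤ)) (T : List α)
    (h : ∀ a ∈ T, Legal (f a) ∧ ∀ p, parity (f a) p = 0) :
    Legal (T.flatMap f) ∧ ∀ p, parity (T.flatMap f) p = 0 := by
  induction T with
  | nil => exact ⟨trivial, fun _ => rfl⟩
  | cons a T ih =>
    have ha := h a (by simp)
    have hT := ih fun b hb => h b (by simp [hb])
    exact ⟨ha.1.append hT.1 hT.2, fun p => by simp [ha.2, hT.2]⟩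

/-- The orbit of `(x, y)` under the symmetries of the board. -/
def orbit (x y : ℤ) : List (ℤ × ℤ) :=
  [(y, x), (-x, y), (-y, -x), (x, -y), (y, -x), (-x, -y), (-y, x), (x, y)]

lemma parity_orbit (x y : ℤ) (p : ℤ × ℤ) : parity (orbit x y) p = 0 := by
  simp only [orbit, parity_cons, parity_nil, lineParity]
  ring_nf
  reduce_mod_char

lemma legal_orbit {x y : ℤ} (hy : 0 < y) (hxy : y < x) : Legal (orbit x y) := by
  simp only [orbit, Legal, parity_cons, parity_nil, lineParity]
  simp (disch := omega) only [if_pos, if_neg]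
  decide

/-- All squares of the board off the central row, column and diagonals. -/
def offStar (m : ℕ) : List (ℤ × ℤ) :=
  (List.range m).flatMap fun a : ℕ =>
    (List.range a).flatMap fun b : ℕ => orbit ((a : ℤ) + 1) ((b : ℤ) + 1)

lemma legal_offStar (m : ℕ) : Legal (offStar m) ∧ ∀ p, parity (offStar m) p = 0 := by
  refine legal_flatMap _ _ fun a _ => legal_flatMap _ _ fun b hb => ⟨?_, parity_orbit _ _⟩
  have := List.mem_range.1 hb
  exact legal_orbit (by omega) (by omega)

lemma length_offStar (m : ℕ) : (offStar m).length + 4 * m = 4 * m ^ 2 := by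
  induction m with
  | zero => rfl
  | succ m ih =>
    have : (offStar (m + 1)).length = (offStar m).length + 8 * m := by
      simp [offStar, List.range_succ, orbit, mul_comm]
    rw [this]; linarith

lemma mem_offStar {m : ℕ} {p : ℤ × ℤ} : p ∈ offStar m ↔
    p.1.natAbs ≤ m ∧ p.2.natAbs ≤ m ∧ p.1 ≠ 0 ∧ p.2 ≠ 0 ∧ p.1.natAbs ≠ p.2.natAbs := by
  obtain ⟨x, y⟩ := p
  simp only [offStar, List.mem_flatMap, List.mem_range, orbit, List.mem_cons, Prod.mk.injEq,
    List.not_mem_nil, or_false]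
  constructor
  · rintro ⟨a, ha, b, hb, h⟩
    omega
  · rintro ⟨hx, hy, hx0, hy0, hxy⟩
    obtain ⟨X, hX⟩ : ∃ X : ℕ, x = X ∨ x = -X := ⟨_, Int.natAbs_eq x⟩
    obtain ⟨Y, hY⟩ : ∃ Y : ℕ, y = Y ∨ y = -Y := ⟨_, Int.natAbs_eq y⟩
    have hX1 : ((X - 1 : ℕ) : ℤ) + 1 = X := by omega
    have hY1 : ((Y - 1 : ℕ) : ℤ) + 1 = Y := by omega
    rcases lt_or_ge Y X with h | h
    · refine ⟨X - 1, by omega, Y - 1, by omega, ?_⟩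
      rw [hX1, hY1]
      rcases hX with rfl | rfl <;> rcases hY with rfl | rfl <;> simp
    · refine ⟨Y - 1, by omega, X - 1, by omega, ?_⟩
      rw [hX1, hY1]
      rcases hX with rfl | rfl <;> rcases hY with rfl | rfl <;> simp

/-- The squares at distance `k` from the centre in the central row and one long diagonal. -/
def ring (k : ℕ) : List (ℤ × ℤ) :=
  if Even k then [(k, -k), (k, 0), (-k, 0), (-k, k)] else [(k, -k), (-k, 0), (-k, k), (k, 0)]

/-- The central row and one long diagonal, without the centre. -/
def halfStar : ℕ → List (ℤ × ℤ)
  | 0 => []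
  | k + 1 => ring (k + 1) ++ halfStar k

lemma mem_halfStar {m : ℕ} {p : ℤ × ℤ} :
    p ∈ halfStar m ↔ p.1 ≠ 0 ∧ p.1.natAbs ≤ m ∧ (p.2 = 0 ∨ p.2 = -p.1) := by
  obtain ⟨x, y⟩ := p
  induction m with
  | zero => simp [halfStar]; omega
  | succ m ih =>
    simp only [halfStar, List.mem_append, ih, ring]
    split_ifs <;> simp only [List.mem_cons, Prod.mk.injEq, List.not_mem_nil, or_false] <;> omega

lemma length_halfStar (m : ℕ) : (halfStar m).length = 4 * m := by
  induction m with
  | zero => rfl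
  | succ m ih => rw [halfStar, List.length_append, ih, ring]; split_ifs <;> simp <;> ring

lemma parity_ring (k : ℕ) (p : ℤ × ℤ) : parity (ring k) p =
    lineParity (k, 0) p + lineParity (-k, 0) p + lineParity (k, -k) p + lineParity (-k, k) p := by
  rw [ring]; split_ifs <;> simp only [parity_cons, parity_nil] <;> ring

lemma parity_halfStar_row {i k : ℕ} (hik : i < k) :
    parity (halfStar i) (k, 0) = (if Even k ∧ k ≤ 2 * i then 1 else 0) ∧
    parity (halfStar i) (-k, 0) = (if Even k ∧ k ≤ 2 * i then 1 else 0) := by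
  induction i with
  | zero => simp [halfStar]; omega
  | succ i ih =>
    obtain ⟨h₁, h₂⟩ := ih (by omega)
    simp only [halfStar, parity_append, h₁, h₂, parity_ring, lineParity]
    rcases lt_trichotomy k (2 * (i + 1)) with h | h | h
    · by_cases hk : Even k
      · have : k ≤ 2 * i := by obtain ⟨r, rfl⟩ := hk; omega
        simp [hk, this, h.le]
        simp (disch := omega) only [if_neg]
        decide
      · simp [hk]
        simp (disch := omega) only [if_neg]
        decide
    · have hk : Even k := ⟨i + 1, by omega⟩
      simp only [hk, true_and]
      push_cast
      simp (disch := omega) only [if_pos, if_neg]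
      decide
    · push_cast
      simp (disch := omega) only [if_neg]
      decide

lemma parity_halfStar_diag {i k : ℕ} (hik : i < k) :
    parity (halfStar i) (k, -k) = 0 ∧ parity (halfStar i) (-k, k) = 0 := by
  induction i with
  | zero => simp [halfStar]
  | succ i ih =>
    obtain ⟨h₁, h₂⟩ := ih (by omega)
    simp only [halfStar, parity_append, h₁, h₂, parity_ring, lineParity]
    push_cast
    simp (disch := omega) only [if_pos, if_neg]
    decide

lemma legal_halfStar (m : ℕ) : Legal (halfStar m) := by
  induction m with
  | zero => trivial
  | succ m ih =>
    obtain ⟨h₁, h₂⟩ := parity_halfStar_row (Nat.lt_succ_self m)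
    obtain ⟨h₃, h₄⟩ := parity_halfStar_diag (Nat.lt_succ_self m)
    rw [halfStar, ring]
    by_cases hk : Even (m + 1)
    · have : m + 1 ≤ 2 * m := by obtain ⟨r, hr⟩ := hk; omega
      simp only [hk, this, Nat.succ_eq_add_one, and_self, if_true] at h₁ h₂ h₃ h₄ ⊢
      simp only [List.cons_append, List.nil_append, Legal, parity_cons, h₁, h₂, h₃, h₄, ih]
      simp only [lineParity]
      push_cast
      simp (disch := omega) only [if_pos, if_neg]
      decide
    · simp only [hk, Nat.succ_eq_add_one, false_and, if_false] at h₁ h₂ h₃ h₄ ⊢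
      simp only [List.cons_append, List.nil_append, Legal, parity_cons, h₁, h₂, h₃, h₄, ih]
      simp only [lineParity]
      push_cast
      simp (disch := omega) only [if_pos, if_neg]
      decide

lemma parity_halfStar_center (m : ℕ) : parity (halfStar m) (0, 0) = 0 := by
  induction m with
  | zero => rfl
  | succ m ih =>
    simp only [halfStar, parity_append, ih, parity_ring, lineParity]
    push_cast
    simp (disch := omega) only [if_pos, if_neg]
    decide

lemma parity_map_rot_ring (k : ℕ) (p : ℤ × ℤ) : parity ((ring k).map rot) p =
    lineParity (0, k) p + lineParity (0, -k) p + lineParity (k, k) p + lineParity (-k, -k) p := by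
  rw [ring]
  split_ifs <;> simp only [List.map_cons, List.map_nil, rot, parity_cons, parity_nil, neg_neg,
    neg_zero] <;> ring

lemma parity_star_of_mem {i : ℕ} {p : ℤ × ℤ} (hp : p.2 ≠ 0) (h : p.1 = 0 ∨ p.1 = p.2) :
    parity ((halfStar i).map rot) p + parity (halfStar i) p = if p.2.natAbs ≤ i then 1 else 0 := by
  obtain ⟨x, y⟩ := p
  induction i with
  | zero => simp at hp; simp [halfStar, hp]
  | succ i ih =>
    have key : parity ((ring (i + 1)).map rot) (x, y) + parity (ring (i + 1)) (x, y) =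
        if y.natAbs = i + 1 then 1 else 0 := by
      rw [parity_map_rot_ring, parity_ring]
      simp only [lineParity] at hp h ⊢
      push_cast
      by_cases hy : y.natAbs = i + 1
      · rcases h with h | h <;> rcases le_total 0 y with h0 | h0
        all_goals
          simp (disch := omega) only [if_pos, if_neg]
          decide
      · rcases h with h | h
        · by_cases h₁ : y = 2 * (i + 1)
          · simp (disch := omega) only [if_pos, if_neg]; decide
          by_cases h₂ : y = -(2 * (i + 1))
          · simp (disch := omega) only [if_pos, if_neg]; decide
          simp (disch := omega) only [if_pos, if_neg]; decide
        · by_cases h₁ : 2 * x = i + 1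
          · simp (disch := omega) only [if_pos, if_neg]; decide
          by_cases h₂ : 2 * x = -(i + 1)
          · simp (disch := omega) only [if_pos, if_neg]; decide
          simp (disch := omega) only [if_pos, if_neg]; decide
    simp only [halfStar, List.map_append, parity_append]
    rw [show ∀ a b c d : ZMod 2, a + b + (c + d) = (a + c) + (b + d) by intros; ring, ih, key]
    rcases lt_trichotomy y.natAbs (i + 1) with h | h | h
    all_goals
      push_cast
      simp (disch := omega) only [if_pos, if_neg]
      decide

/-- A complete game on the board `[-m, m] × [-m, m]`, last move first. -/
def completeGame (m : ℕ) : List (ℤ × ℤ) :=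
  ((halfStar m).map rot).reverse ++ (0, 0) :: (halfStar m ++ offStar m)

lemma legal_completeGame (m : ℕ) : Legal (completeGame m) := by
  refine (legal_halfStar m).map_rot.reverse_append ⟨?_, ?_⟩ fun p hp => ?_
  · rw [parity_append, (legal_offStar m).2, parity_halfStar_center, add_zero]
  · exact (legal_halfStar m).append (legal_offStar m).1 (legal_offStar m).2
  · obtain ⟨⟨x, y⟩, hs, rfl⟩ := List.mem_map.1 hp
    obtain ⟨hx, hxm, hy⟩ := mem_halfStar.1 hs
    have hstar := parity_star_of_mem (i := m) (p := rot (x, y)) hx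
      (by simp only [rot] at hy ⊢; omega)
    have hcenter : lineParity (0, 0) (rot (x, y)) = 1 := by
      simp only [rot] at hx hy ⊢
      simp only [lineParity]
      rcases hy with hy | hy <;> simp (disch := omega) only [if_pos, if_neg] <;> decide
    have hxm' : (rot (x, y)).2.natAbs ≤ m := hxm
    rw [if_pos hxm'] at hstar
    rw [parity_cons, parity_append, (legal_offStar m).2, hcenter, add_zero, add_left_comm, hstar]
    decide

lemma mem_completeGame {m : ℕ} {p : ℤ × ℤ} :
    p ∈ completeGame m ↔ p.1.natAbs ≤ m ∧ p.2.natAbs ≤ m := by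
  obtain ⟨x, y⟩ := p
  have : (x, y) ∈ (halfStar m).map rot ↔ (y, -x) ∈ halfStar m := by
    simp only [List.mem_map, rot, Prod.mk.injEq]
    constructor
    · rintro ⟨⟨a, b⟩, h, rfl, rfl⟩
      simpa using h
    · exact fun h => ⟨_, h, by simp⟩
  simp only [completeGame, List.mem_append, List.mem_reverse, List.mem_cons, this, mem_halfStar,
    mem_offStar, Prod.mk.injEq]
  omega

lemma length_completeGame (m : ℕ) : (completeGame m).length = (2 * m + 1) ^ 2 := by
  have := length_offStar m
  simp only [completeGame, List.length_append, List.length_reverse, List.length_map,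
    List.length_cons, length_halfStar]
  linarith

lemma Legal.exists_sequence {L : List (ℤ × ℤ)} (hL : Legal L) :
    ∃ q : Fin L.length → ℤ × ℤ, (∀ s, s ∈ L ↔ ∃ i, q i = s) ∧
      (∀ p, ∑ i, lineParity (q i) p = parity L p) ∧
      ∀ i, ∑ j, (if j < i then lineParity (q j) (q i) else 0) = 0 := by
  induction L with
  | nil => exact ⟨fun _ => 0, by simp⟩
  | cons p L ih =>
    obtain ⟨q, hmem, hsum, hq⟩ := ih hL.2
    refine ⟨Fin.snoc (α := fun _ => ℤ × ℤ) q p, fun s => ?_, fun r => ?_, fun i => ?_⟩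
    · constructor
      · intro hs
        rcases List.mem_cons.1 hs with rfl | hs
        · exact ⟨Fin.last _, by simp⟩
        · obtain ⟨i, hi⟩ := (hmem s).1 hs
          exact ⟨i.castSucc, by simp [hi]⟩
      · rintro ⟨i, rfl⟩
        refine Fin.lastCases ?_ (fun i => ?_) i
        · simp
        · simpa using Or.inr ((hmem _).2 ⟨i, rfl⟩)
    · erw [Fin.sum_univ_castSucc]
      simp [hsum, add_comm]
    · refine Fin.lastCases ?_ (fun i => ?_) i
      · erw [Fin.sum_univ_castSucc]
        simp [Fin.castSucc_lt_last, hsum, hL.1]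
      · erw [Fin.sum_univ_castSucc]
        simpa [Fin.castSucc_lt_castSucc_iff, (Fin.le_last _).not_gt] using hq i

/-- The translation from the centred board to the board with coordinates `1, …, 2 * m + 1`. -/
def shift (m : ℕ) (p : ℤ × ℤ) : ℕ × ℕ := ((p.1 + m + 1).toNat, (p.2 + m + 1).toNat)

lemma ite_attacks_shift {m : ℕ} {s p : ℤ × ℤ} (hs : s.1.natAbs ≤ m ∧ s.2.natAbs ≤ m)
    (hp : p.1.natAbs ≤ m ∧ p.2.natAbs ≤ m) :
    (if attacks (shift m s) (shift m p) then 1 else 0 : ZMod 2) = lineParity s p := by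
  obtain ⟨a, b⟩ := s
  obtain ⟨c, d⟩ := p
  by_cases h : (a, b) = (c, d)
  · rw [h]; simp [attacks]
  · have h' : ¬ (a = c ∧ b = d) := by simpa using h
    simp only [attacks, shift, lineParity, ne_eq, Prod.mk.injEq] at hs hp ⊢
    by_cases h₁ : a = c
    · simp (disch := omega) only [if_pos, if_neg]; decide
    by_cases h₂ : b = d
    · simp (disch := omega) only [if_pos, if_neg]; decide
    by_cases h₃ : a + b = c + d
    · simp (disch := omega) only [if_pos, if_neg]; decide
    by_cases h₄ : a - b = c - d
    · simp (disch := omega) only [if_pos, if_neg]; decide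
    simp (disch := omega) only [if_neg]; decide

end QueenParity

open QueenParity in
/-- For every odd positive integer `n`, there is a complete legal game sequence on the
`n × n` chessboard: a legal game sequence of length `n ^ 2` enumerating all squares. -/
theorem odd_board_has_complete_solution (n : ℕ) (hpos : 0 < n) (hodd : Odd n) :
    ∃ q : Fin (n ^ 2) → ℕ × ℕ, IsLegalSeq n q ∧ ∀ s ∈ board n, ∃ i, q i = s := by
  obtain ⟨m, rfl⟩ := hodd
  obtain ⟨q, hmem, -, hq⟩ := (legal_completeGame m).exists_sequence
  rw [← length_completeGame m]
  have hbound (i) : (q i).1.natAbs ≤ m ∧ (q i).2.natAbs ≤ m := mem_completeGame.1 ((hmem _).2 ⟨i, rfl⟩)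
  have hboard (i) : shift m (q i) ∈ board (2 * m + 1) := by
    have := hbound i
    simp only [board, shift, Finset.mem_product, Finset.mem_Icc]
    omega
  have hsurj : ∀ s ∈ board (2 * m + 1), ∃ i, shift m (q i) = s := by
    rintro ⟨a, b⟩ hs
    simp only [board, Finset.mem_product, Finset.mem_Icc] at hs
    obtain ⟨i, hi⟩ := (hmem ((a : ℤ) - m - 1, (b : ℤ) - m - 1)).1
      (mem_completeGame.2 ⟨by simp only; omega, by simp only; omega⟩)
    exact ⟨i, by rw [hi]; simp only [shift, Prod.mk.injEq]; omega⟩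
  refine ⟨fun i => shift m (q i), ⟨?_, hboard, fun i => ?_⟩, hsurj⟩
  · have hbij : Function.Bijective
        (fun i => (⟨shift m (q i), hboard i⟩ : board (2 * m + 1))) := by
      rw [Fintype.bijective_iff_surjective_and_card]
      refine ⟨fun s => ?_, ?_⟩
      · obtain ⟨i, hi⟩ := hsurj s.1 s.2
        exact ⟨i, Subtype.ext hi⟩
      · rw [Fintype.card_fin, Fintype.card_coe, length_completeGame]
        simp [board, sq]
    exact fun i j hij => hbij.1 (Subtype.ext hij)
  · rw [← ZMod.natCast_eq_zero_iff_even, Finset.card_filter, Nat.cast_sum, ← hq i]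
    refine Finset.sum_congr rfl fun j _ => ?_
    rw [← ite_attacks_shift (hbound j) (hbound i), ite_and]
    split_ifs <;> simp
end

section
/- For every even integer n ≥ 4, there exists a legal game sequence of length n² − 2 on the n×n chessboard. -/
/-- A list of squares, most recent first, in which every square is new and is attacked by an
even number of the squares played before it. -/
def LegalHistory : List (ℕ × ℕ) → Prop
  | [] => True
  | p :: l => p ∉ l ∧ Even (l.countP fun s => attacks s p) ∧ LegalHistory l

instance : DecidablePred LegalHistory := fun l => by
  induction l with
  | nil => exact isTrue trivial
  | cons p l ih => exact inferInstanceAs (Decidable (_ ∧ _ ∧ _))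

theorem LegalHistory.nodup : ∀ {l : List (ℕ × ℕ)}, LegalHistory l → l.Nodup
  | [], _ => List.nodup_nil
  | _ :: _, h => List.nodup_cons.2 ⟨h.1, h.2.2.nodup⟩

theorem LegalHistory.append : ∀ {l r : List (ℕ × ℕ)}, LegalHistory l → LegalHistory r →
    (∀ p ∈ l, p ∉ r) → (∀ p ∈ l, Even (r.countP fun s => attacks s p)) → LegalHistory (l ++ r)
  | [], _, _, hr, _, _ => hr
  | p :: l, r, hl, hr, hd, he => by
    refine ⟨?_, ?_, hl.2.2.append hr (fun q hq => hd q (by simp [hq]))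
      (fun q hq => he q (by simp [hq]))⟩
    · simpa [hl.1] using hd p (by simp)
    · change Even ((l ++ r).countP _)
      rw [List.countP_append]
      exact hl.2.1.add (he p (by simp))

theorem attacks_mk {a b c d : ℕ} : attacks (a, b) (c, d) ↔
    ¬ (a = c ∧ b = d) ∧ (a = c ∨ b = d ∨ a + b = c + d ∨ a + d = c + b) := by
  rw [attacks, ne_eq, Prod.mk.injEq]

theorem attacks_shift (p q : ℕ × ℕ) :
    attacks (p.1 + 1, p.2 + 1) (q.1 + 1, q.2 + 1) ↔ attacks p q := by
  obtain ⟨a, b⟩ := p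
  obtain ⟨c, d⟩ := q
  rw [attacks_mk, attacks_mk]
  omega

theorem LegalHistory.shift : ∀ {l : List (ℕ × ℕ)}, LegalHistory l →
    LegalHistory (l.map fun p => (p.1 + 1, p.2 + 1))
  | [], _ => trivial
  | p :: l, h => by
    refine ⟨?_, ?_, h.2.2.shift⟩
    · rintro hp
      obtain ⟨q, hq, e⟩ := List.mem_map.1 hp
      simp only [Prod.mk.injEq, add_left_inj] at e
      exact h.1 (Prod.ext e.1 e.2 ▸ hq)
    · rw [List.countP_map]
      simpa only [Function.comp_def, attacks_shift] using h.2.1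

theorem LegalHistory.exists_fin : ∀ {l : List (ℕ × ℕ)}, LegalHistory l →
    ∃ q : Fin l.length → ℕ × ℕ, Function.Injective q ∧ Finset.univ.image q = l.toFinset ∧
      ∀ i, Even ((Finset.univ.filter fun j => j < i ∧ attacks (q j) (q i)).card)
  | [], _ => ⟨fun i => i.elim0, fun i => i.elim0, by ext; simp, fun i => i.elim0⟩
  | p :: l, h => by
    obtain ⟨q, hinj, him, heven⟩ := h.2.2.exists_fin
    have hmem : ∀ x, (∃ i, q i = x) ↔ x ∈ l := fun x => by
      simpa using congrArg (x ∈ ·) him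
    refine ⟨Fin.snoc (α := fun _ => ℕ × ℕ) q p, ?_, ?_, ?_⟩
    · rw [Fin.snoc_injective_iff]
      exact ⟨hinj, fun hp => h.1 ((hmem p).1 hp)⟩
    · ext x
      simp only [Finset.mem_image, Finset.mem_univ, true_and, List.mem_toFinset, List.mem_cons,
        ← hmem]
      constructor
      · rintro ⟨i, rfl⟩
        induction i using Fin.lastCases with
        | last => simp
        | cast i => simp
      · rintro (rfl | ⟨i, rfl⟩)
        · exact ⟨Fin.last _, by simp⟩
        · exact ⟨i.castSucc, by simp⟩
    · intro i
      rw [Finset.card_filter]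
      erw [Fin.sum_univ_castSucc]
      induction i using Fin.lastCases with
      | last =>
        simp only [Fin.snoc_castSucc, Fin.snoc_last, lt_self_iff_false, false_and, if_false,
          add_zero, Fin.castSucc_lt_last, true_and]
        rw [← Finset.card_filter]
        have := h.2.1
        rw [List.countP_eq_length_filter, ← List.toFinset_card_of_nodup (h.2.2.nodup.filter _),
          List.toFinset_filter, ← him, Finset.filter_image,
          Finset.card_image_of_injective _ hinj] at this
        simpa using this
      | cast i =>
        have := heven i
        rw [Finset.card_filter] at this
        simpa [(Fin.castSucc_lt_last i).not_gt, Fin.castSucc_lt_castSucc_iff] using this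

/-- The eight images of `(1, j)` under the symmetries of the `n × n` board, ordered as a legal
history. -/
def orbit (n j : ℕ) : List (ℕ × ℕ) :=
  [(1, j), (n, n + 1 - j), (1, n + 1 - j), (n, j),
    (j, 1), (n + 1 - j, n), (n + 1 - j, 1), (j, n)]

/-- The corners of the `n × n` board together with the orbit of `(1, 2)`, ordered as a legal
history. -/
def cornerOrbit (n : ℕ) : List (ℕ × ℕ) :=
  [(1, 2), (1, 1), (n, 1), (1, n), (n, n), (n, n - 1), (1, n - 1), (n, 2),
    (2, 1), (n - 1, n), (n - 1, 1), (2, n)]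

/-- The squares of the frame of the `n × n` board at distance at most `k + 1` from a corner. -/
def partialFrame (n : ℕ) : ℕ → List (ℕ × ℕ)
  | 0 => cornerOrbit n
  | k + 1 => orbit n (k + 3) ++ partialFrame n k

theorem even_countP_cons_of_attacks {p q : ℕ × ℕ} {l : List (ℕ × ℕ)} (h : attacks q p) :
    Even ((q :: l).countP fun s => attacks s p) ↔ ¬ Even (l.countP fun s => attacks s p) := by
  rw [List.countP_cons_of_pos (by simpa using h), Nat.even_add_one]

theorem even_countP_cons_of_not_attacks {p q : ℕ × ℕ} {l : List (ℕ × ℕ)} (h : ¬ attacks q p) :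
    Even ((q :: l).countP fun s => attacks s p) ↔ Even (l.countP fun s => attacks s p) := by
  rw [List.countP_cons_of_neg (by simpa using h)]

theorem legalHistory_orbit {n j : ℕ} (hj : 2 ≤ j) (hn : 2 * j ≤ n) :
    LegalHistory (orbit n j) := by
  simp only [orbit, LegalHistory]
  refine ⟨?_, ?_, ?_, ?_, ?_, ?_, ?_, ?_, ?_, ?_, ?_, ?_, ?_, ?_, ?_, ?_, trivial⟩ <;>
  first
  | exact List.not_mem_nil
  | (simp only [List.mem_cons, Prod.mk.injEq, List.not_mem_nil, or_false]; omega)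
  | (simp (disch := (rw [attacks_mk]; omega)) only
      [even_countP_cons_of_attacks, even_countP_cons_of_not_attacks, List.countP_nil, Even.zero,
        not_true_eq_false, not_false_eq_true])

theorem legalHistory_cornerOrbit {n : ℕ} (hn : 4 ≤ n) : LegalHistory (cornerOrbit n) := by
  simp only [cornerOrbit, LegalHistory]
  refine ⟨?_, ?_, ?_, ?_, ?_, ?_, ?_, ?_, ?_, ?_, ?_, ?_, ?_, ?_, ?_, ?_, ?_, ?_, ?_, ?_, ?_, ?_,
    ?_, ?_, trivial⟩ <;>
  first
  | exact List.not_mem_nil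
  | (simp only [List.mem_cons, Prod.mk.injEq, List.not_mem_nil, or_false]; omega)
  | (simp (disch := (rw [attacks_mk]; omega)) only
      [even_countP_cons_of_attacks, even_countP_cons_of_not_attacks, List.countP_nil, Even.zero,
        not_true_eq_false, not_false_eq_true])

theorem even_countP_orbit {n i j : ℕ} (hi : 2 ≤ i) (hij : i < j) (hn : 2 * j ≤ n) :
    ∀ p ∈ orbit n j, Even ((orbit n i).countP fun s => attacks s p) := by
  intro p hp
  simp only [orbit, List.mem_cons, List.not_mem_nil, or_false] at hp
  rcases hp with rfl | rfl | rfl | rfl | rfl | rfl | rfl | rfl <;>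
  (rw [orbit]
   simp (disch := (rw [attacks_mk]; omega)) only
      [even_countP_cons_of_attacks, even_countP_cons_of_not_attacks, List.countP_nil, Even.zero,
        not_true_eq_false, not_false_eq_true])

theorem even_countP_cornerOrbit {n j : ℕ} (hj : 2 < j) (hn : 2 * j ≤ n) :
    ∀ p ∈ orbit n j, Even ((cornerOrbit n).countP fun s => attacks s p) := by
  intro p hp
  simp only [orbit, List.mem_cons, List.not_mem_nil, or_false] at hp
  rcases hp with rfl | rfl | rfl | rfl | rfl | rfl | rfl | rfl <;>
  (rw [cornerOrbit]
   simp (disch := (rw [attacks_mk]; omega)) only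
      [even_countP_cons_of_attacks, even_countP_cons_of_not_attacks, List.countP_nil, Even.zero,
        not_true_eq_false, not_false_eq_true])

theorem even_countP_partialFrame {n j : ℕ} (hn : 2 * j ≤ n) : ∀ {k : ℕ}, k + 2 < j →
    ∀ p ∈ orbit n j, Even ((partialFrame n k).countP fun s => attacks s p)
  | 0, hk, p, hp => even_countP_cornerOrbit hk hn p hp
  | k + 1, hk, p, hp => by
    rw [partialFrame, List.countP_append]
    exact (even_countP_orbit (by omega) hk hn p hp).add
      (even_countP_partialFrame hn (by omega) p hp)

theorem mem_partialFrame {n : ℕ} {p : ℕ × ℕ} : ∀ {k : ℕ}, 2 * k + 4 ≤ n →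
    (p ∈ partialFrame n k ↔ (1 ≤ p.1 ∧ p.1 ≤ n ∧ 1 ≤ p.2 ∧ p.2 ≤ n) ∧
      ((p.1 = 1 ∨ p.1 = n) ∧ (p.2 ≤ k + 2 ∨ n ≤ p.2 + k + 1) ∨
        (p.2 = 1 ∨ p.2 = n) ∧ (p.1 ≤ k + 2 ∨ n ≤ p.1 + k + 1)))
  | 0, hk => by
    obtain ⟨a, b⟩ := p
    simp only [partialFrame, cornerOrbit, List.mem_cons, Prod.mk.injEq, List.not_mem_nil, or_false]
    omega
  | k + 1, hk => by
    rw [partialFrame, List.mem_append, mem_partialFrame (by omega)]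
    obtain ⟨a, b⟩ := p
    simp only [orbit, List.mem_cons, Prod.mk.injEq, List.not_mem_nil, or_false]
    omega

theorem legalHistory_partialFrame {n : ℕ} : ∀ {k : ℕ}, 2 * k + 4 ≤ n →
    LegalHistory (partialFrame n k)
  | 0, hk => legalHistory_cornerOrbit (by omega)
  | k + 1, hk => by
    refine (legalHistory_orbit (by omega) (by omega)).append
      (legalHistory_partialFrame (by omega)) ?_
      (even_countP_partialFrame (by omega) (by omega))
    rintro ⟨a, b⟩ hp
    rw [mem_partialFrame (by omega)]
    simp only [orbit, List.mem_cons, Prod.mk.injEq, List.not_mem_nil, or_false] at hp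
    omega

theorem length_partialFrame (n : ℕ) : ∀ k, (partialFrame n k).length = 8 * k + 12
  | 0 => rfl
  | k + 1 => by
    rw [partialFrame, List.length_append, length_partialFrame n k, orbit]
    simp only [List.length_cons, List.length_nil]
    omega

theorem mem_frame {k : ℕ} {p : ℕ × ℕ} : p ∈ partialFrame (2 * k + 4) k ↔
    (1 ≤ p.1 ∧ p.1 ≤ 2 * k + 4 ∧ 1 ≤ p.2 ∧ p.2 ≤ 2 * k + 4) ∧
      (p.1 = 1 ∨ p.1 = 2 * k + 4 ∨ p.2 = 1 ∨ p.2 = 2 * k + 4) := by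
  rw [mem_partialFrame le_rfl]
  omega

/-- A square off the list shares at most one line with each square of the list. -/
theorem countP_attacks {a b : ℕ} : ∀ {l : List (ℕ × ℕ)}, (a, b) ∉ l →
    (l.countP fun s => attacks s (a, b)) =
      (l.countP fun s => s.1 = a) + (l.countP fun s => s.2 = b) +
        (l.countP fun s => s.1 + s.2 = a + b) + (l.countP fun s => s.1 + b = a + s.2)
  | [], _ => rfl
  | (c, d) :: l, h => by
    simp only [List.mem_cons, Prod.mk.injEq, not_or] at h
    have ih := countP_attacks h.2
    have hne := h.1
    simp only [List.countP_cons, ih, attacks_mk, decide_eq_true_eq]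
    split_ifs <;> omega

theorem even_countP_of_mem_iff {l : List (ℕ × ℕ)} (hl : l.Nodup) {P : ℕ × ℕ → Prop}
    [DecidablePred P] (x y : ℕ × ℕ) (hxy : x ≠ y) (h : ∀ s, s ∈ l ∧ P s ↔ s = x ∨ s = y) :
    Even (l.countP fun s => P s) := by
  have hp : (l.filter fun s => P s).Perm [x, y] :=
    (List.perm_ext_iff_of_nodup (hl.filter _) (by simpa using hxy)).2 fun s => by simpa using h s
  rw [List.countP_eq_length_filter, hp.length_eq]
  exact even_two

/-- Each of the four lines through an interior square meets the frame in two squares. -/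
theorem even_countP_frame {k a b : ℕ} (ha : 1 < a) (ha' : a < 2 * k + 4) (hb : 1 < b)
    (hb' : b < 2 * k + 4) :
    Even ((partialFrame (2 * k + 4) k).countP fun s => attacks s (a, b)) := by
  have hd := (legalHistory_partialFrame (n := 2 * k + 4) (k := k) le_rfl).nodup
  rw [countP_attacks (by rw [mem_frame]; omega)]
  refine ((Even.add ?_ ?_).add ?_).add ?_
  · refine even_countP_of_mem_iff hd (a, 1) (a, 2 * k + 4) ?_ ?_
    · rw [ne_eq, Prod.mk.injEq]
      omega
    · rintro ⟨c, d⟩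
      rw [mem_frame, Prod.mk.injEq, Prod.mk.injEq]
      omega
  · refine even_countP_of_mem_iff hd (1, b) (2 * k + 4, b) ?_ ?_
    · rw [ne_eq, Prod.mk.injEq]
      omega
    · rintro ⟨c, d⟩
      rw [mem_frame, Prod.mk.injEq, Prod.mk.injEq]
      omega
  · rcases le_total (a + b) (2 * k + 5) with h | h
    · refine even_countP_of_mem_iff hd (1, a + b - 1) (a + b - 1, 1) ?_ ?_
      · rw [ne_eq, Prod.mk.injEq]
        omega
      · rintro ⟨c, d⟩
        rw [mem_frame, Prod.mk.injEq, Prod.mk.injEq]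
        omega
    · refine even_countP_of_mem_iff hd (2 * k + 4, a + b - (2 * k + 4))
        (a + b - (2 * k + 4), 2 * k + 4) ?_ ?_
      · rw [ne_eq, Prod.mk.injEq]
        omega
      · rintro ⟨c, d⟩
        rw [mem_frame, Prod.mk.injEq, Prod.mk.injEq]
        omega
  · rcases le_total a b with h | h
    · refine even_countP_of_mem_iff hd (1, b + 1 - a) (2 * k + 4 + a - b, 2 * k + 4) ?_ ?_
      · rw [ne_eq, Prod.mk.injEq]
        omega
      · rintro ⟨c, d⟩
        rw [mem_frame, Prod.mk.injEq, Prod.mk.injEq]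
        omega
    · refine even_countP_of_mem_iff hd (a + 1 - b, 1) (2 * k + 4, 2 * k + 4 + b - a) ?_ ?_
      · rw [ne_eq, Prod.mk.injEq]
        omega
      · rintro ⟨c, d⟩
        rw [mem_frame, Prod.mk.injEq, Prod.mk.injEq]
        omega

theorem exists_legalHistory : ∀ k : ℕ, ∃ l : List (ℕ × ℕ), LegalHistory l ∧
    l.length = (2 * k + 4) ^ 2 - 2 ∧ ∀ p ∈ l, p ∈ board (2 * k + 4)
  | 0 => ⟨[(1, 4), (1, 1), (2, 2), (1, 2), (2, 3), (2, 4), (3, 2), (3, 1), (3, 3), (4, 3), (4, 1),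
      (4, 4), (3, 4), (4, 2)], by decide, rfl, by decide⟩
  | k + 1 => by
    obtain ⟨l, hl, hlen, hmem⟩ := exists_legalHistory k
    have hint : ∀ p ∈ l.map fun p => (p.1 + 1, p.2 + 1),
        (1 < p.1 ∧ p.1 < 2 * (k + 1) + 4) ∧ (1 < p.2 ∧ p.2 < 2 * (k + 1) + 4) := by
      intro p hp
      obtain ⟨q, hq, rfl⟩ := List.mem_map.1 hp
      have := hmem q hq
      simp only [board, Finset.mem_product, Finset.mem_Icc] at this
      dsimp only
      omega
    refine ⟨(l.map fun p => (p.1 + 1, p.2 + 1)) ++ partialFrame (2 * (k + 1) + 4) (k + 1),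
      hl.shift.append (legalHistory_partialFrame le_rfl) ?_ ?_, ?_, ?_⟩
    · intro p hp
      have := hint p hp
      rw [mem_frame]
      omega
    · rintro ⟨a, b⟩ hp
      obtain ⟨⟨h₁, h₂⟩, h₃, h₄⟩ := hint _ hp
      exact even_countP_frame h₁ h₂ h₃ h₄
    · rw [List.length_append, List.length_map, hlen, length_partialFrame]
      ring_nf
      omega
    · intro p hp
      simp only [board, Finset.mem_product, Finset.mem_Icc]
      rcases List.mem_append.1 hp with hp | hp
      · have := hint p hp
        omega
      · have := mem_frame.1 hp
        omega

/-- For every even integer `n ≥ 4`, there exists a legal game sequence of length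
`n ^ 2 - 2` on the `n × n` chessboard. -/
theorem even_board_near_complete (n : ℕ) (hn : 4 ≤ n) (heven : Even n) :
    ∃ q : Fin (n ^ 2 - 2) → ℕ × ℕ, IsLegalSeq n q := by
  obtain ⟨k, rfl⟩ : ∃ k, n = 2 * k + 4 := by
    obtain ⟨m, rfl⟩ := heven
    exact ⟨m - 2, by omega⟩
  obtain ⟨l, hl, hlen, hmem⟩ := exists_legalHistory k
  obtain ⟨q, hinj, him, hq⟩ := hl.exists_fin
  rw [← hlen]
  refine ⟨q, hinj, fun i => hmem _ ?_, hq⟩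
  rw [← List.mem_toFinset, ← him]
  exact Finset.mem_image_of_mem q (Finset.mem_univ i)
end

section
/- Let n be an even positive integer and let q₁, …, q_k be pairwise distinct squares of the n×n chessboard. Then for each index i, the move qᵢ is legal in the complementary game — i.e., the number of squares p ∉ {q₁, …, q_{i−1}} with p ≠ qᵢ that attack qᵢ is even — if and only if the move qᵢ is legal in the alternate universe game — i.e., the number of indices j < i for which q_j attacks qᵢ is odd. Consequently, for even n the complementary mod 2 n-queens games are in bijection with the alternate universe mod 2 n-queens games. -/
/-- The queen on `(a, b)` attacks the squares of its row, column and two diagonals. -/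
lemma filter_attacks_eq_union (n a b : ℕ) (hab : (a, b) ∈ board n) :
    ((board n).filter fun p => attacks p (a, b)) =
      ((((Finset.Icc 1 n).erase b).image fun y => (a, y)) ∪
        (((Finset.Icc 1 n).erase a).image fun x => (x, b))) ∪
      ((((Finset.Icc (max 1 (a + b - n)) (min n (a + b - 1))).erase a).image
          fun x => (x, a + b - x)) ∪
        (((Finset.Icc (max 1 (a + 1 - b)) (min n (a + n - b))).erase a).image
          fun x => (x, x + b - a))) := by
  simp only [board, Finset.mem_product, Finset.mem_Icc] at hab
  ext ⟨x, y⟩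
  rw [Finset.mem_filter]
  simp only [attacks, board, Finset.mem_product, Finset.mem_Icc, Finset.mem_union,
    Finset.mem_image, Finset.mem_erase, Prod.mk.injEq, ne_eq]
  constructor
  · rintro ⟨hxy, hne, h | h | h | h⟩
    · exact Or.inl (Or.inl ⟨y, by omega⟩)
    · exact Or.inl (Or.inr ⟨x, by omega⟩)
    · exact Or.inr (Or.inl ⟨x, by omega⟩)
    · exact Or.inr (Or.inr ⟨x, by omega⟩)
  · rintro ((⟨z, h⟩ | ⟨z, h⟩) | (⟨z, h⟩ | ⟨z, h⟩)) <;> omega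

/-- On a board of even side, every square is attacked by an odd number of squares. -/
lemma odd_card_filter_attacks {n : ℕ} (heven : Even n) {c : ℕ × ℕ} (hc : c ∈ board n) :
    Odd ((board n).filter fun p => attacks p c).card := by
  obtain ⟨a, b⟩ := c
  rw [filter_attacks_eq_union n a b hc]
  simp only [board, Finset.mem_product, Finset.mem_Icc] at hc
  rw [Finset.card_union_of_disjoint, Finset.card_union_of_disjoint,
    Finset.card_union_of_disjoint, Finset.card_image_of_injective,
    Finset.card_image_of_injective, Finset.card_image_of_injective,
    Finset.card_image_of_injective, Finset.card_erase_of_mem, Finset.card_erase_of_mem,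
    Finset.card_erase_of_mem, Finset.card_erase_of_mem]
  · simp only [Nat.card_Icc]
    rw [Nat.odd_iff]
    rw [Nat.even_iff] at heven
    omega
  iterate 4 simp only [Finset.mem_Icc]; omega
  iterate 4
    intro x y h
    simp only [Prod.mk.injEq] at h
    omega
  all_goals
    rw [Finset.disjoint_left]
    rintro ⟨x, y⟩ h h'
    simp only [Finset.mem_Icc, Finset.mem_union, Finset.mem_image, Finset.mem_erase,
      Prod.mk.injEq, ne_eq] at h h'
  · obtain ⟨u, h⟩ := h
    obtain ⟨v, h'⟩ := h'
    omega
  · obtain ⟨u, h⟩ := h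
    obtain ⟨v, h'⟩ := h'
    omega
  · obtain ⟨u, h⟩ | ⟨u, h⟩ := h <;> obtain ⟨v, h'⟩ | ⟨v, h'⟩ := h' <;> omega

/-- The attackers of `q i` split into those among the earlier squares and the others. -/
lemma card_filter_attacks_eq_add {n k : ℕ} {q : Fin k → ℕ × ℕ} (hinj : Function.Injective q)
    (hboard : ∀ i, q i ∈ board n) (i : Fin k) :
    ((board n).filter fun p => attacks p (q i)).card =
      (Finset.univ.filter fun j : Fin k => j < i ∧ attacks (q j) (q i)).card +
      ((board n).filter fun p => (∀ j : Fin k, j < i → p ≠ q j) ∧ attacks p (q i)).card := by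
  rw [← Finset.card_image_of_injective _ hinj, ← Finset.card_union_of_disjoint]
  · congr 1
    ext p
    simp only [Finset.mem_filter, Finset.mem_union, Finset.mem_image, Finset.mem_univ, true_and]
    constructor
    · rintro ⟨hp, hatt⟩
      by_cases h : ∃ j, j < i ∧ p = q j
      · obtain ⟨j, hj, rfl⟩ := h
        exact Or.inl ⟨j, ⟨hj, hatt⟩, rfl⟩
      · exact Or.inr ⟨hp, fun j hj hpj => h ⟨j, hj, hpj⟩, hatt⟩
    · rintro (⟨j, ⟨-, hatt⟩, rfl⟩ | ⟨hp, -, hatt⟩)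
      · exact ⟨hboard j, hatt⟩
      · exact ⟨hp, hatt⟩
  · rw [Finset.disjoint_left]
    intro p hp hp'
    simp only [Finset.mem_filter, Finset.mem_image, Finset.mem_univ, true_and] at hp hp'
    obtain ⟨j, ⟨hj, -⟩, rfl⟩ := hp
    exact hp'.2.1 j hj rfl

/-- For even `n`, a move is legal in the complementary game iff it is legal in the
alternate universe game; hence the two games are in bijection. -/
theorem complementary_iff_alternate (n : ℕ) (hpos : 0 < n) (heven : Even n)
    {k : ℕ} (q : Fin k → ℕ × ℕ) (hinj : Function.Injective q)
    (hboard : ∀ i, q i ∈ board n) (i : Fin k) :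
    (Even (((board n).filter fun p =>
        (∀ j : Fin k, j < i → p ≠ q j) ∧ attacks p (q i)).card) ↔
      Odd ((Finset.univ.filter fun j : Fin k => j < i ∧ attacks (q j) (q i)).card)) := by
  have hodd := odd_card_filter_attacks heven (hboard i)
  rw [card_filter_attacks_eq_add hinj hboard i, Nat.odd_add] at hodd
  exact hodd.symm
end
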